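/- arXiv:2410.22760 — 3 statements merged into one kernel-verified Lean document; each statement's English description precedes it below -/
import Mathlib

section
/- Let m ∈ ℕ, n : Fin m → ℕ, and N = ∑_{i} n(i), and let (B_S, c_S) be the associated 3-cost game instance. Then there exists a strategy s for B_S such that P*_s is closed and ∑_{p ∈ final(P*_s)} C(p) ≤ c_S componentwise if and only if there exists a subset T ⊆ Fin m with ∑_{i ∈ T} n(i) = ∑_{i ∉ T} n(i). (Correctness of the paper's reduction from Distinct Partition to the k-cost reachability game problem, used in the proof of Theorem 4.) -/
open Classical

/-- A `k`-cost game board: positions `P` (finite) partitioned into controller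
positions `Pc` (`P∘`) and spoiler positions `Psq` (`P□`), an initial position `p0`,
a set `F` of final positions with no outgoing edges, a cost function `C : P → ℝ^k`,
and an acyclic edge relation `M`. -/
structure CostGameBoard (k : ℕ) (P : Type) [Fintype P] where
  Pc : Set P
  Psq : Set P
  p0 : P
  F : Set P
  C : P → Fin k → ℝ
  M : P → P → Prop
  cover : Pc ∪ Psq = Set.univ
  disj : Pc ∩ Psq = ∅
  acyclic : ∀ p : P, ¬ Relation.TransGen M p p
  final_no_out : ∀ p ∈ F, ∀ p' : P, ¬ M p p'

variable {k : ℕ} {P : Type} [Fintype P]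

/-- `s` is a strategy: whenever the last position of a nonempty sequence has an
outgoing `M`-edge, the strategy picks an `M`-successor of it. -/
def IsStrategy (B : CostGameBoard k P) (s : List P → P) : Prop :=
  ∀ (ρ : List P) (p : P), ρ.getLast? = some p → (∃ p', B.M p p') → B.M p (s ρ)

/-- `ρ` is a successful play generated by `s`: it is nonempty, starts at `p0`,
follows `M`-edges, ends in `F`, and follows `s` at controller positions. -/
def IsPlay (B : CostGameBoard k P) (s : List P → P) (ρ : List P) : Prop :=
  ρ ≠ [] ∧
  ρ.head? = some B.p0 ∧
  (∀ (i : ℕ) (p p' : P), ρ[i]? = some p → ρ[i + 1]? = some p' → B.M p p') ∧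
  (∃ p ∈ B.F, ρ.getLast? = some p) ∧
  (∀ (i : ℕ) (p p' : P), ρ[i]? = some p → ρ[i + 1]? = some p' →
      p ∈ B.Pc → p' = s (ρ.take (i + 1)))

/-- `P*_s`: the set of successful plays generated by `s`. -/
def Plays (B : CostGameBoard k P) (s : List P → P) : Set (List P) :=
  {ρ | IsPlay B s ρ}

/-- `P*_s` is closed: at every spoiler position occurring (not last) in a play,
every alternative spoiler move can be extended to a play with the same prefix. -/
def ClosedPlays (B : CostGameBoard k P) (s : List P → P) : Prop :=
  ∀ ρ ∈ Plays B s, ∀ (i : ℕ) (p p' : P), ρ[i]? = some p → i + 1 < ρ.length →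
    p ∈ B.Psq → B.M p p' →
      ∃ ρ' ∈ Plays B s, ρ'.take (i + 1) = ρ.take (i + 1) ∧ ρ'[i + 1]? = some p'

/-- `final(P*_s)`: the set of last positions of successful plays generated by `s`. -/
def finals (B : CostGameBoard k P) (s : List P → P) : Set P :=
  {p | ∃ ρ ∈ Plays B s, ρ.getLast? = some p}

/-- The `j`-th component of `∑_{p ∈ final(P*_s)} C(p)`. -/
noncomputable def finalCost (B : CostGameBoard k P) (s : List P → P) (j : Fin k) : ℝ :=
  ∑ p ∈ (Set.toFinite (finals B s)).toFinset, B.C p j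

/-- Positions of the board `B_S` associated with a Distinct Partition instance:
the initial position `p₀`, and for each index `i` the positions `pⁱ`, `pⁱ↑`, `pⁱ↓`. -/
inductive PartPos (m : ℕ) : Type
  | start : PartPos m
  | mid : Fin m → PartPos m
  | up : Fin m → PartPos m
  | down : Fin m → PartPos m
  deriving DecidableEq, Fintype

/-- Edges of the board `B_S`. -/
inductive partM (m : ℕ) : PartPos m → PartPos m → Prop
  | toMid (i : Fin m) : partM m .start (.mid i)
  | toUp (i : Fin m) : partM m (.mid i) (.up i)
  | toDown (i : Fin m) : partM m (.mid i) (.down i)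

/-- Costs of the board `B_S`: `C(pⁱ↑) = (n i, 0, 1)`, `C(pⁱ↓) = (0, n i, 1)`,
and `(0,0,0)` elsewhere. -/
def partC {m : ℕ} (n : Fin m → ℕ) : PartPos m → Fin 3 → ℝ
  | .up i => ![(n i : ℝ), 0, 1]
  | .down i => ![0, (n i : ℝ), 1]
  | _ => ![0, 0, 0]

/-- Rank function witnessing acyclicity of `partM`. -/
def partRank {m : ℕ} : PartPos m → ℕ
  | .start => 0
  | .mid _ => 1
  | .up _ => 2
  | .down _ => 2

lemma partM_rank {m : ℕ} {p q : PartPos m} (h : partM m p q) : partRank p < partRank q := by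
  cases h <;> simp [partRank]

/-- The 3-cost game board `B_S` associated with a Distinct Partition instance. -/
def partBoard (m : ℕ) (n : Fin m → ℕ) : CostGameBoard 3 (PartPos m) where
  Pc := {p | p ≠ .start}
  Psq := {.start}
  p0 := .start
  F := {p | ∃ i : Fin m, p = .up i ∨ p = .down i}
  C := partC n
  M := partM m
  cover := by
    ext p
    by_cases h : p = PartPos.start <;> simp [h]
  disj := by
    ext p
    simp only [Set.mem_inter_iff, Set.mem_setOf_eq, Set.mem_singleton_iff, Set.mem_empty_iff_false,
      iff_false, not_and]
    tauto
  acyclic := by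
    intro p hp
    have key : ∀ a b : PartPos m, Relation.TransGen (partM m) a b → partRank a < partRank b := by
      intro a b h
      induction h with
      | single h => exact partM_rank h
      | tail _ h ih => exact ih.trans (partM_rank h)
    exact lt_irrefl _ (key p p hp)
  final_no_out := by
    rintro p ⟨i, hi | hi⟩ p' hM <;> subst hi <;> cases hM

/-- A successful play of the partition board visits `p₀`, some `pⁱ`, and the strategy's answer. -/
lemma isPlay_partBoard_iff {m : ℕ} {n : Fin m → ℕ} {s : List (PartPos m) → PartPos m}
    (hs : IsStrategy (partBoard m n) s) (ρ : List (PartPos m)) :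
    IsPlay (partBoard m n) s ρ ↔ ∃ i, ρ = [.start, .mid i, s [.start, .mid i]] := by
  constructor
  · rintro ⟨-, hhead, hM, ⟨q, ⟨j, hq⟩, hlast⟩, hctrl⟩
    match ρ with
    | [] => simp at hhead
    | [a] =>
      obtain rfl : a = .start := by simpa [partBoard] using hhead
      obtain rfl : PartPos.start = q := by simpa using hlast
      simp at hq
    | [a, b] =>
      obtain rfl : a = .start := by simpa [partBoard] using hhead
      obtain rfl : b = q := by simpa using hlast
      have h : partM m .start b := hM 0 _ _ rfl rfl
      cases h
      simp at hq
    | [a, b, c] =>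
      obtain rfl : a = .start := by simpa [partBoard] using hhead
      have h : partM m .start b := hM 0 _ _ rfl rfl
      cases h with
      | toMid i =>
        have hc : c = s [.start, .mid i] := hctrl 1 _ _ rfl rfl (by simp [partBoard])
        exact ⟨i, by rw [← hc]⟩
    | a :: b :: c :: d :: l =>
      obtain rfl : a = .start := by simpa [partBoard] using hhead
      have h₀ := partM_rank (hM 0 _ _ rfl rfl)
      have h₁ := partM_rank (hM 1 _ _ rfl rfl)
      have h₂ := partM_rank (hM 2 _ _ rfl rfl)
      have hd : partRank d ≤ 2 := by cases d <;> simp [partRank]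
      omega
  · rintro ⟨i, rfl⟩
    have hi : partM m (.mid i) (s [.start, .mid i]) := hs _ _ rfl ⟨_, partM.toUp i⟩
    refine ⟨by simp, rfl, ?_, ⟨_, ?_, rfl⟩, ?_⟩
    · rintro (_ | _ | k) p p' hp hp'
      · obtain rfl : PartPos.start = p := by simpa using hp
        obtain rfl : PartPos.mid i = p' := by simpa using hp'
        exact partM.toMid i
      · obtain rfl : PartPos.mid i = p := by simpa using hp
        obtain rfl : s [.start, .mid i] = p' := by simpa using hp'
        exact hi
      · simp at hp'
    · generalize s [.start, .mid i] = q at hi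
      cases hi
      · exact ⟨i, .inl rfl⟩
      · exact ⟨i, .inr rfl⟩
    · rintro (_ | _ | k) p p' hp hp' hc
      · obtain rfl : PartPos.start = p := by simpa using hp
        simp [partBoard] at hc
      · obtain rfl : s [.start, .mid i] = p' := by simpa using hp'
        rfl
      · simp at hp'

lemma closedPlays_partBoard {m : ℕ} {n : Fin m → ℕ} {s : List (PartPos m) → PartPos m}
    (hs : IsStrategy (partBoard m n) s) : ClosedPlays (partBoard m n) s := by
  intro ρ hρ k p p' hp _ hsq hM
  obtain ⟨i, rfl⟩ := (isPlay_partBoard_iff hs ρ).1 hρ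
  obtain rfl : p = .start := hsq
  have hi : partM m (.mid i) (s [.start, .mid i]) := hs _ _ rfl ⟨_, partM.toUp i⟩
  have hM' : partM m .start p' := hM
  cases hM' with
  | toMid j =>
    refine ⟨_, (isPlay_partBoard_iff hs _).2 ⟨j, rfl⟩, ?_⟩
    match k with
    | 0 => simp
    | 1 => simp at hp
    | 2 =>
      have hq : s [.start, .mid i] = .start := by simpa using hp
      rw [hq] at hi
      cases hi
    | k + 3 => simp at hp

/-- The answer of a strategy at `pⁱ` is `pⁱ↑` or `pⁱ↓`. -/
lemma answer_eq_up_or_down {m : ℕ} {n : Fin m → ℕ} {s : List (PartPos m) → PartPos m}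
    (hs : IsStrategy (partBoard m n) s) (i : Fin m) :
    s [.start, .mid i] = .up i ∨ s [.start, .mid i] = .down i := by
  have hi : partM m (.mid i) (s [.start, .mid i]) := hs _ _ rfl ⟨_, partM.toUp i⟩
  generalize s [.start, .mid i] = q at hi
  cases hi
  · exact .inl rfl
  · exact .inr rfl

lemma finalCost_partBoard {m : ℕ} {n : Fin m → ℕ} {s : List (PartPos m) → PartPos m}
    (hs : IsStrategy (partBoard m n) s) (j : Fin 3) :
    finalCost (partBoard m n) s j = ∑ i, partC n (s [.start, .mid i]) j := by
  have hinj : Function.Injective fun i : Fin m => s [.start, .mid i] := by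
    intro a b hab
    rcases answer_eq_up_or_down hs a with ha | ha <;>
      rcases answer_eq_up_or_down hs b with hb | hb <;> simpa [ha, hb] using hab
  have hfin : (Set.toFinite (finals (partBoard m n) s)).toFinset =
      Finset.univ.image fun i : Fin m => s [.start, .mid i] := by
    ext p
    simp only [Set.Finite.mem_toFinset, Finset.mem_image, Finset.mem_univ, true_and]
    constructor
    · rintro ⟨ρ, hρ, hp⟩
      obtain ⟨i, rfl⟩ := (isPlay_partBoard_iff hs ρ).1 hρ
      exact ⟨i, by simpa using hp⟩
    · rintro ⟨i, rfl⟩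
      exact ⟨_, (isPlay_partBoard_iff hs _).2 ⟨i, rfl⟩, rfl⟩
  rw [finalCost, hfin, Finset.sum_image hinj.injOn]
  rfl

/-- The final cost of a strategy that answers `pⁱ↑` exactly for `i ∈ T`. -/
lemma finalCost_partBoard_of_up_iff {m : ℕ} {n : Fin m → ℕ} {s : List (PartPos m) → PartPos m}
    (hs : IsStrategy (partBoard m n) s) {T : Finset (Fin m)}
    (hT : ∀ i, s [.start, .mid i] = .up i ↔ i ∈ T) :
    finalCost (partBoard m n) s =
      ![((∑ i ∈ T, n i : ℕ) : ℝ), ((∑ i ∈ Tᶜ, n i : ℕ) : ℝ), (m : ℝ)] := by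
  have hC : ∀ i, partC n (s [.start, .mid i]) =
      ![if i ∈ T then (n i : ℝ) else 0, if i ∈ Tᶜ then (n i : ℝ) else 0, 1] := by
    intro i
    by_cases hi : i ∈ T
    · simp [(hT i).2 hi, hi, partC]
    · have hd := (answer_eq_up_or_down hs i).resolve_left (mt (hT i).1 hi)
      simp [hd, hi, partC]
  ext j
  rw [finalCost_partBoard hs]
  simp only [hC]
  fin_cases j
  · simp
  · simp only [Fin.mk_one, Matrix.cons_val_one, Matrix.cons_val_zero]
    rw [Finset.sum_ite_mem, Finset.univ_inter, Nat.cast_sum]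
  · simp

/-- The strategy that answers `pⁱ↑` for `i ∈ T` and `pⁱ↓` otherwise. -/
lemma exists_isStrategy_up_iff {m : ℕ} (n : Fin m → ℕ) (T : Finset (Fin m)) :
    ∃ s, IsStrategy (partBoard m n) s ∧ ∀ i, s [.start, .mid i] = .up i ↔ i ∈ T := by
  let next : PartPos m → PartPos m := fun p =>
    match p with
    | .mid i => if i ∈ T then .up i else .down i
    | p => if h : ∃ q, partM m p q then h.choose else p
  refine ⟨fun ρ => next (ρ.getLast?.getD .start), ?_, ?_⟩
  · intro ρ p hp hq
    have hq' : ∃ q, partM m p q := hq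
    change partM m p (next (ρ.getLast?.getD .start))
    rw [hp, Option.getD_some]
    cases p with
    | mid i =>
      by_cases hi : i ∈ T
      · simpa [next, hi] using partM.toUp i
      · simpa [next, hi] using partM.toDown i
    | start => simpa only [next, dif_pos hq'] using hq'.choose_spec
    | up i => simpa only [next, dif_pos hq'] using hq'.choose_spec
    | down i => simpa only [next, dif_pos hq'] using hq'.choose_spec
  · intro i
    by_cases hi : i ∈ T <;> simp [next, hi]

/-- Correctness of the reduction from Distinct Partition to the `k`-cost
reachability game problem: the instance `(B_S, c_S)` with
`c_S = (N/2, N/2, m)` admits a solving strategy iff the numbers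
`n 0, …, n (m-1)` admit an equal-sum partition. -/
theorem partBoard_solvable_iff_partition (m : ℕ) (n : Fin m → ℕ) :
    (∃ s : List (PartPos m) → PartPos m,
        IsStrategy (partBoard m n) s ∧ ClosedPlays (partBoard m n) s ∧
        ∀ j : Fin 3, finalCost (partBoard m n) s j ≤
          ![((∑ i, n i : ℕ) : ℝ) / 2, ((∑ i, n i : ℕ) : ℝ) / 2, (m : ℝ)] j) ↔
      (∃ T : Finset (Fin m), ∑ i ∈ T, n i = ∑ i ∈ Tᶜ, n i) := by
  have hsum (T : Finset (Fin m)) :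
      ((∑ i, n i : ℕ) : ℝ) = ((∑ i ∈ T, n i : ℕ) : ℝ) + ((∑ i ∈ Tᶜ, n i : ℕ) : ℝ) := by
    rw [← Finset.sum_add_sum_compl T n, Nat.cast_add]
  constructor
  · rintro ⟨s, hs, -, hcost⟩
    let T : Finset (Fin m) := {i | s [.start, .mid i] = .up i}
    rw [finalCost_partBoard_of_up_iff hs (T := T) (by simp [T]), hsum T] at hcost
    have h₀ : ((∑ i ∈ T, n i : ℕ) : ℝ) ≤ _ := hcost 0
    have h₁ : ((∑ i ∈ Tᶜ, n i : ℕ) : ℝ) ≤ _ := hcost 1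
    refine ⟨T, ?_⟩
    rw [← Nat.cast_inj (R := ℝ)]
    simp only [Matrix.cons_val_zero, Matrix.cons_val_one] at h₀ h₁
    linarith
  · rintro ⟨T, hT⟩
    obtain ⟨s, hs, hup⟩ := exists_isStrategy_up_iff n T
    refine ⟨s, hs, closedPlays_partBoard hs, fun j => ?_⟩
    rw [finalCost_partBoard_of_up_iff hs hup, hsum T, ← hT, add_self_div_two]
end

section
/- Let B be a k-cost game board in which every position p ∈ P ∖ F has at least one outgoing M-edge, let c ∈ ℝ^k, and let σ : P∘ ∖ F → P be a function with (p, σ(p)) ∈ M for every p ∈ P∘ ∖ F. Let s be the positional strategy induced by σ, i.e., s(ρ) = σ(last(ρ)), and let M' = {(p, p') ∈ M : p ∈ P□} ∪ {(p, σ(p)) : p ∈ P∘ ∖ F}. Then: (i) P*_s is closed; (ii) final(P*_s) equals the set F' of positions of F reachable from p₀ along edges of M'; and consequently (iii) s solves the instance (B, c) if and only if ∑_{p ∈ F'} C(p) ≤ c componentwise. (This is the certificate characterization used by the paper to show the positional k-cost game problem lies in NP.) -/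
open Classical

variable {k : ℕ} {P : Type} [Fintype P]

/-- `s` solves the instance `(B, c)`: `P*_s` is closed and the total cost of the
final positions is componentwise at most `c`. -/
def Solves (B : CostGameBoard k P) (c : Fin k → ℝ) (s : List P → P) : Prop :=
  ClosedPlays B s ∧ ∀ j, finalCost B s j ≤ c j

/-- The edges compatible with the positional choice function `σ`: all spoiler edges, and the
`σ`-edges at non-final controller positions. -/
def PositionalEdge (B : CostGameBoard k P) (σ : P → P) (p q : P) : Prop :=
  (B.M p q ∧ p ∈ B.Psq) ∨ (p ∈ B.Pc ∧ p ∉ B.F ∧ q = σ p)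

/-- The converse of the edge relation of a finite acyclic board is well-founded. -/
theorem CostGameBoard.wellFounded_swap (B : CostGameBoard k P) :
    WellFounded (Function.swap B.M) := by
  have : Std.Irrefl (Relation.TransGen (Function.swap B.M)) :=
    ⟨fun p h => B.acyclic p (Relation.transGen_swap.mp h)⟩
  exact Subrelation.wf (Relation.TransGen.single)
    (Finite.wellFounded_of_trans_of_irrefl (Relation.TransGen (Function.swap B.M)))

theorem CostGameBoard.mem_Psq_iff (B : CostGameBoard k P) (p : P) : p ∈ B.Psq ↔ p ∉ B.Pc := by
  have hc : p ∈ B.Pc ∪ B.Psq := B.cover ▸ Set.mem_univ p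
  have hd : p ∉ B.Pc ∩ B.Psq := B.disj ▸ Set.notMem_empty p
  grind

/-- From every position, some path of `PositionalEdge`s leads to a final position. -/
theorem exists_isChain_positionalEdge_to_final {B : CostGameBoard k P} {σ : P → P}
    (hout : ∀ p : P, p ∉ B.F → ∃ p', B.M p p')
    (hσ : ∀ p : P, p ∈ B.Pc → p ∉ B.F → B.M p (σ p)) (p : P) :
    ∃ l : List P, (p :: l).IsChain (PositionalEdge B σ) ∧
      ∃ q ∈ B.F, (p :: l).getLast? = some q := by
  induction p using B.wellFounded_swap.induction with
  | _ p ih =>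
    by_cases hF : p ∈ B.F
    · exact ⟨[], .singleton p, p, hF, rfl⟩
    obtain ⟨p', hM, hE⟩ : ∃ p', B.M p p' ∧ PositionalEdge B σ p p' := by
      by_cases hc : p ∈ B.Pc
      · exact ⟨σ p, hσ p hc hF, .inr ⟨hc, hF, rfl⟩⟩
      · obtain ⟨p', hM⟩ := hout p hF
        exact ⟨p', hM, .inl ⟨hM, (B.mem_Psq_iff p).mpr hc⟩⟩
    obtain ⟨l, hl, q, hq, hlast⟩ := ih p' hM
    exact ⟨p' :: l, .cons_cons hE hl, q, hq, by rwa [List.getLast?_cons_cons]⟩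

/-- The successful plays of a positional strategy are the `PositionalEdge`-paths from `p₀` to a
final position. -/
theorem isPlay_iff_isChain_positionalEdge {B : CostGameBoard k P} {σ : P → P}
    (hσ : ∀ p : P, p ∈ B.Pc → p ∉ B.F → B.M p (σ p))
    {s : List P → P} (hs : ∀ (ρ : List P) (p : P), ρ.getLast? = some p → s ρ = σ p)
    (ρ : List P) :
    IsPlay B s ρ ↔ ρ.head? = some B.p0 ∧ ρ.IsChain (PositionalEdge B σ) ∧
      ∃ p ∈ B.F, ρ.getLast? = some p := by
  have hs_take (i : ℕ) (p : P) (hp : ρ[i]? = some p) : s (ρ.take (i + 1)) = σ p :=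
    hs _ _ (by simp [List.getLast?_take, hp])
  constructor
  · rintro ⟨-, hhead, hM, hlast, hctrl⟩
    refine ⟨hhead, List.isChain_iff_getElem.mpr fun i hi => ?_, hlast⟩
    have hp : ρ[i]? = some ρ[i] := List.getElem?_eq_getElem _
    have hp' : ρ[i + 1]? = some ρ[i + 1] := List.getElem?_eq_getElem _
    have hedge := hM i _ _ hp hp'
    by_cases hc : ρ[i] ∈ B.Pc
    · exact .inr ⟨hc, fun hF => B.final_no_out _ hF _ hedge,
        (hctrl i _ _ hp hp' hc).trans (hs_take i _ hp)⟩
    · exact .inl ⟨hedge, (B.mem_Psq_iff _).mpr hc⟩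
  · rintro ⟨hhead, hchain, hlast⟩
    have hedge (i : ℕ) (p p' : P) (hp : ρ[i]? = some p) (hp' : ρ[i + 1]? = some p') :
        PositionalEdge B σ p p' := by
      obtain ⟨_, rfl⟩ := List.getElem?_eq_some_iff.mp hp
      obtain ⟨hi, rfl⟩ := List.getElem?_eq_some_iff.mp hp'
      exact List.isChain_iff_getElem.mp hchain i hi
    refine ⟨by rintro rfl; simp at hhead, hhead, fun i p p' hp hp' => ?_, hlast,
      fun i p p' hp hp' hc => ?_⟩
    · rcases hedge i p p' hp hp' with ⟨hM, -⟩ | ⟨hc, hF, rfl⟩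
      · exact hM
      · exact hσ p hc hF
    · rcases hedge i p p' hp hp' with ⟨-, hsq⟩ | ⟨-, -, rfl⟩
      · exact absurd hc ((B.mem_Psq_iff p).mp hsq)
      · exact (hs_take i p hp).symm

theorem closedPlays_of_positional {B : CostGameBoard k P} {σ : P → P}
    (hout : ∀ p : P, p ∉ B.F → ∃ p', B.M p p')
    (hσ : ∀ p : P, p ∈ B.Pc → p ∉ B.F → B.M p (σ p))
    {s : List P → P} (hs : ∀ (ρ : List P) (p : P), ρ.getLast? = some p → s ρ = σ p) :
    ClosedPlays B s := by
  intro ρ hρ i p p' hp hi hsq hM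
  obtain ⟨hhead, hchain, -⟩ := (isPlay_iff_isChain_positionalEdge hσ hs ρ).mp hρ
  obtain ⟨l, hl, q, hq, hlast⟩ := exists_isChain_positionalEdge_to_final hout hσ p'
  have hlen : (ρ.take (i + 1)).length = i + 1 := by simp; omega
  refine ⟨ρ.take (i + 1) ++ p' :: l,
    (isPlay_iff_isChain_positionalEdge hσ hs _).mpr ⟨?_, ?_, q, hq, ?_⟩, ?_, ?_⟩
  · simp [List.head?_append, List.head?_take, hhead]
  · refine List.isChain_append.mpr ⟨hchain.take _, hl, fun x hx y hy => ?_⟩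
    obtain rfl : p = x := by simpa [List.getLast?_take, hp] using hx
    obtain rfl : p' = y := by simpa using hy
    exact .inl ⟨hM, hsq⟩
  · simp [List.getLast?_append, hlast]
  · exact List.take_left' hlen
  · rw [List.getElem?_append_right hlen.le, hlen]
    simp

theorem finals_eq_of_positional {B : CostGameBoard k P} {σ : P → P}
    (hσ : ∀ p : P, p ∈ B.Pc → p ∉ B.F → B.M p (σ p))
    {s : List P → P} (hs : ∀ (ρ : List P) (p : P), ρ.getLast? = some p → s ρ = σ p) :
    finals B s = {p | p ∈ B.F ∧ Relation.ReflTransGen (PositionalEdge B σ) B.p0 p} := by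
  ext p
  constructor
  · rintro ⟨ρ, hρ, hp⟩
    obtain ⟨hhead, hchain, q, hq, hlast⟩ := (isPlay_iff_isChain_positionalEdge hσ hs ρ).mp hρ
    obtain rfl : q = p := Option.some.inj (hlast.symm.trans hp)
    obtain ⟨l, rfl⟩ := List.head?_eq_some_iff.mp hhead
    refine ⟨hq, List.relationReflTransGen_of_exists_isChain_cons l hchain ?_⟩
    rwa [List.getLast?_eq_some_getLast (List.cons_ne_nil _ _), Option.some.injEq] at hlast
  · rintro ⟨hF, hreach⟩
    obtain ⟨l, hchain, hlast⟩ := List.exists_isChain_cons_of_relationReflTransGen hreach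
    have hend : (B.p0 :: l).getLast? = some p := by
      rw [List.getLast?_eq_some_getLast (List.cons_ne_nil _ _), hlast]
    exact ⟨B.p0 :: l,
      (isPlay_iff_isChain_positionalEdge hσ hs _).mpr ⟨rfl, hchain, p, hF, hend⟩, hend⟩

/-- Certificate characterization used to put the positional `k`-cost game problem
in NP.  If every non-final position has an outgoing edge, `σ` picks an `M`-successor
of every controller non-final position, `s` is the positional strategy induced by
`σ`, and `M'` is the subgraph keeping all spoiler edges and only the `σ`-edges at
controller positions, then: (i) `P*_s` is closed; (ii) `final(P*_s)` is the set
`F'` of final positions reachable from `p₀` along `M'`; and (iii) `s` solves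
`(B, c)` iff `∑_{p ∈ F'} C(p) ≤ c` componentwise. -/
theorem positional_certificate
    (k : ℕ) (P : Type) [Fintype P] (B : CostGameBoard k P) (c : Fin k → ℝ)
    (hout : ∀ p : P, p ∉ B.F → ∃ p', B.M p p')
    (σ : P → P) (hσ : ∀ p : P, p ∈ B.Pc → p ∉ B.F → B.M p (σ p))
    (s : List P → P) (hs : ∀ (ρ : List P) (p : P), ρ.getLast? = some p → s ρ = σ p)
    (M' : P → P → Prop)
    (hM' : ∀ p p' : P, M' p p' ↔
      (B.M p p' ∧ p ∈ B.Psq) ∨ (p ∈ B.Pc ∧ p ∉ B.F ∧ p' = σ p))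
    (F' : Set P)
    (hF' : F' = {p | p ∈ B.F ∧ Relation.ReflTransGen M' B.p0 p}) :
    ClosedPlays B s ∧
    finals B s = F' ∧
    (Solves B c s ↔ ∀ j : Fin k, ∑ p ∈ (Set.toFinite F').toFinset, B.C p j ≤ c j) := by
  obtain rfl : M' = PositionalEdge B σ := funext₂ fun p p' => propext (hM' p p')
  have hclosed : ClosedPlays B s := closedPlays_of_positional hout hσ hs
  have hfinals : finals B s = F' := (finals_eq_of_positional hσ hs).trans hF'.symm
  refine ⟨hclosed, hfinals, ?_⟩
  simp only [Solves, hclosed, true_and, finalCost, hfinals]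
end

section
/- Let P and T be finite sets, incoming : T → Finset P, D : P → ℕ a duration function, and q : P → Option ℕ a state. Assume no transition is enabled in q, and that the set T̄ = {t ∈ T : q(p) is defined for every p ∈ incoming(t)} is nonempty. Then incoming(t) is nonempty for every t ∈ T̄; and setting k_t = max_{p ∈ incoming(t)} (D(p) − q(p)) (truncated subtraction, maximum over the nonempty finite set incoming(t)) for t ∈ T̄ and k = min_{t ∈ T̄} k_t, we have: k ≥ 1, some transition of T is enabled in the state q + k, and for every j < k no transition of T is enabled in the state q + j. (Correctness of the Saturate procedure: q + k is the first saturated state reached from q by waiting, i.e., q + k = sat(q).) -/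
/-- A transition `t` is enabled in a state `q` if every incoming place `p` is
active (`q p = some x`) and has been active for at least its duration `D p`. -/
def Enabled {P T : Type} (incoming : T → Finset P) (D : P → ℕ)
    (q : P → Option ℕ) (t : T) : Prop :=
  ∀ p ∈ incoming t, ∃ x : ℕ, q p = some x ∧ D p ≤ x

/-- The state `q + j`: every active place gets `j` additional time units; inactive
places stay inactive. -/
def addTime {P : Type} (q : P → Option ℕ) (j : ℕ) : P → Option ℕ :=
  fun p => (q p).map (· + j)

theorem enabled_addTime_iff {P T : Type} (incoming : T → Finset P) (D : P → ℕ)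
    (q : P → Option ℕ) (j : ℕ) (t : T) :
    Enabled incoming D (addTime q j) t ↔
      (∀ p ∈ incoming t, (q p).isSome) ∧
        ((incoming t).sup fun p => D p - (q p).getD 0) ≤ j := by
  rw [Finset.sup_le_iff, ← forall₂_and]
  refine forall₂_congr fun p _ => ?_
  cases h : q p <;> simp [addTime, h]
  omega

theorem addTime_zero {P : Type} (q : P → Option ℕ) : addTime q 0 = q := by
  funext p
  simp [addTime]

/-- Correctness of the `Saturate` procedure.  Assume no transition is enabled in
`q` and the set `T̄` of transitions all of whose incoming places are active is
nonempty.  Then every `t ∈ T̄` has a nonempty set of incoming places, and with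
`k_t = max_{p ∈ incoming t} (D p − q p)` (truncated subtraction) and
`k = min_{t ∈ T̄} k_t`, we have `k ≥ 1`, some transition is enabled in `q + k`,
and no transition is enabled in `q + j` for any `j < k`; i.e. `q + k = sat q`
is the first saturated state reached from `q` by waiting. -/
theorem saturate_correct {P T : Type} [Fintype P] [Fintype T]
    (incoming : T → Finset P) (D : P → ℕ) (q : P → Option ℕ)
    (hnotsat : ∀ t : T, ¬ Enabled incoming D q t)
    (Tbar : Finset T)
    (hTbar : ∀ t : T, t ∈ Tbar ↔ ∀ p ∈ incoming t, (q p).isSome)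
    (hne : Tbar.Nonempty) :
    (∀ t ∈ Tbar, (incoming t).Nonempty) ∧
    (∀ k : ℕ,
      k = Tbar.inf' hne (fun t => (incoming t).sup fun p => D p - (q p).getD 0) →
        1 ≤ k ∧
        (∃ t : T, Enabled incoming D (addTime q k) t) ∧
        (∀ j < k, ∀ t : T, ¬ Enabled incoming D (addTime q j) t)) := by
  have hlt : ∀ j < Tbar.inf' hne (fun t => (incoming t).sup fun p => D p - (q p).getD 0),
      ∀ t : T, ¬ Enabled incoming D (addTime q j) t := by
    intro j hj t ht
    obtain ⟨hact, hle⟩ := (enabled_addTime_iff incoming D q j t).1 ht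
    exact absurd ((Finset.inf'_le _ ((hTbar t).2 hact)).trans hle) (not_le.2 hj)
  obtain ⟨t, ht, hmin⟩ := Finset.exists_mem_eq_inf' hne
    (fun t => (incoming t).sup fun p => D p - (q p).getD 0)
  have hen := (enabled_addTime_iff incoming D q _ t).2 ⟨(hTbar t).1 ht, hmin.ge⟩
  refine ⟨fun t _ => ?_, ?_⟩
  · by_contra hempty
    rw [Finset.not_nonempty_iff_eq_empty] at hempty
    exact hnotsat t (by simp [Enabled, hempty])
  · rintro k rfl
    refine ⟨Nat.one_le_iff_ne_zero.2 fun h0 => hnotsat t ?_, ⟨t, hen⟩, hlt⟩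
    rwa [h0, addTime_zero] at hen
end
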